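/- arXiv:2101.01756 — 2 statements merged into one kernel-verified Lean document; each statement's English description precedes it below -/
import Mathlib

section
/- Let f and g be linearly independent homogeneous polynomials of degree d in ℂ[x,y,z], spanning a pencil P, and let (a_x, a_y, a_z) be a normalized weight triple. Then for any nonzero member f' of P there exists a member h of P, not proportional to f', such that ω(P) ≤ ω(f') + ω(h), where ω(P) is computed from the minors of the generators f and g. -/
/-- The coefficient `f_{ij}` of the monomial `x^i y^j z^(d-i-j)` in a polynomial
`f ∈ ℂ[x,y,z]`, regarded as a plane curve of degree `d`. -/
noncomputable def coeffIJ (d : ℕ) (f : MvPolynomial (Fin 3) ℂ) (i j : ℕ) : ℂ :=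
  MvPolynomial.coeff
    (Finsupp.single (0 : Fin 3) i + Finsupp.single (1 : Fin 3) j +
      Finsupp.single (2 : Fin 3) (d - i - j)) f

/-- A normalized weight triple `(ax, ay, az)`:
`ax ≥ ay ≥ az`, `ax > 0` and `ax + ay + az = 0`. -/
def NormTriple (ax ay az : ℤ) : Prop :=
  ay ≤ ax ∧ az ≤ ay ∧ 0 < ax ∧ ax + ay + az = 0

/-- The affine weight `ω(f) = min {(ax-az)·i + (ay-az)·j : f_{ij} ≠ 0}` of a plane
curve of degree `d` at a normalized weight triple. -/
noncomputable def curveWeight (ax ay az : ℤ) (d : ℕ) (f : MvPolynomial (Fin 3) ℂ) : ℤ :=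
  sInf {w : ℤ | ∃ i j : ℕ, coeffIJ d f i j ≠ 0 ∧
    w = (ax - az) * (i : ℤ) + (ay - az) * (j : ℤ)}

/-- The Plücker coordinate (2×2 minor) `m_{ijkl} = f_{ij} g_{kl} - g_{ij} f_{kl}`
of the pencil spanned by `f` and `g`. -/
noncomputable def minor (d : ℕ) (f g : MvPolynomial (Fin 3) ℂ) (i j k l : ℕ) : ℂ :=
  coeffIJ d f i j * coeffIJ d g k l - coeffIJ d g i j * coeffIJ d f k l

/-- The affine weight `ω(P) = min {(ax-az)(i+k) + (ay-az)(j+l) : m_{ijkl} ≠ 0}` of the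
pencil spanned by `f` and `g` at a normalized weight triple. -/
noncomputable def pencilWeight (ax ay az : ℤ) (d : ℕ) (f g : MvPolynomial (Fin 3) ℂ) : ℤ :=
  sInf {w : ℤ | ∃ i j k l : ℕ, minor d f g i j k l ≠ 0 ∧
    w = (ax - az) * ((i : ℤ) + (k : ℤ)) + (ay - az) * ((j : ℤ) + (l : ℤ))}

lemma exists_coeffIJ_ne_zero {d : ℕ} {f : MvPolynomial (Fin 3) ℂ}
    (hf : f.IsHomogeneous d) (hf0 : f ≠ 0) : ∃ i j : ℕ, coeffIJ d f i j ≠ 0 := by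
  obtain ⟨m, hm⟩ := MvPolynomial.ne_zero_iff.mp hf0
  have hdeg : m 0 + m 1 + m 2 = d := by
    have hw : m.degree = d := by
      rw [← hf hm, Finsupp.degree_eq_weight_one]
      rfl
    rw [← hw, Finsupp.degree_eq_sum, Fin.sum_univ_three]
  refine ⟨m 0, m 1, ?_⟩
  have hm' : Finsupp.single (0 : Fin 3) (m 0) + Finsupp.single (1 : Fin 3) (m 1) +
      Finsupp.single (2 : Fin 3) (d - m 0 - m 1) = m := by
    ext k
    fin_cases k
    · simp
    · simp
    · simp
      omega
  rwa [coeffIJ, hm']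

lemma coeffIJ_smul_add_smul (d : ℕ) (u v : ℂ) (f g : MvPolynomial (Fin 3) ℂ) (i j : ℕ) :
    coeffIJ d (u • f + v • g) i j = u * coeffIJ d f i j + v * coeffIJ d g i j := by
  simp [coeffIJ]

lemma exists_curveWeight_eq {ax ay az : ℤ} (hnorm : NormTriple ax ay az) {d : ℕ}
    {f : MvPolynomial (Fin 3) ℂ} (hf : f.IsHomogeneous d) (hf0 : f ≠ 0) :
    ∃ i j : ℕ, coeffIJ d f i j ≠ 0 ∧
      curveWeight ax ay az d f = (ax - az) * (i : ℤ) + (ay - az) * (j : ℤ) := by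
  obtain ⟨i, j, hij⟩ := exists_coeffIJ_ne_zero hf hf0
  obtain ⟨hxy, hyz, -, -⟩ := hnorm
  have hx : 0 ≤ ax - az := by linarith
  have hy : 0 ≤ ay - az := by linarith
  refine Int.csInf_mem (s := {w : ℤ | ∃ i j : ℕ, coeffIJ d f i j ≠ 0 ∧
    w = (ax - az) * (i : ℤ) + (ay - az) * (j : ℤ)}) ⟨_, i, j, hij, rfl⟩ ⟨0, ?_⟩
  rintro _ ⟨k, l, -, rfl⟩
  positivity

lemma pencilWeight_le {ax ay az : ℤ} (hnorm : NormTriple ax ay az) {d : ℕ}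
    {f g : MvPolynomial (Fin 3) ℂ} {i j k l : ℕ} (hm : minor d f g i j k l ≠ 0) :
    pencilWeight ax ay az d f g ≤
      (ax - az) * ((i : ℤ) + (k : ℤ)) + (ay - az) * ((j : ℤ) + (l : ℤ)) := by
  obtain ⟨hxy, hyz, -, -⟩ := hnorm
  have hx : 0 ≤ ax - az := by linarith
  have hy : 0 ≤ ay - az := by linarith
  refine csInf_le ⟨0, ?_⟩ ⟨i, j, k, l, hm, rfl⟩
  rintro _ ⟨i, j, k, l, -, rfl⟩
  positivity

/-- For any nonzero member `f'` of the pencil spanned by `f` and `g`,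
there is a member `h` of the pencil, not proportional to `f'`, with
`ω(P) ≤ ω(f') + ω(h)`. -/
theorem exists_member_pencilWeight_le_add
    (d : ℕ) (hd : 1 ≤ d) (f g : MvPolynomial (Fin 3) ℂ)
    (hf : f.IsHomogeneous d) (hg : g.IsHomogeneous d)
    (hind : LinearIndependent ℂ ![f, g])
    (ax ay az : ℤ) (hnorm : NormTriple ax ay az)
    (f' : MvPolynomial (Fin 3) ℂ)
    (hf'mem : f' ∈ Submodule.span ℂ ({f, g} : Set (MvPolynomial (Fin 3) ℂ)))
    (hf'0 : f' ≠ 0) :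
    ∃ h ∈ Submodule.span ℂ ({f, g} : Set (MvPolynomial (Fin 3) ℂ)),
      (¬ ∃ c : ℂ, h = c • f') ∧
      pencilWeight ax ay az d f g ≤ curveWeight ax ay az d f' + curveWeight ax ay az d h := by
  obtain ⟨a, b, rfl⟩ := Submodule.mem_span_pair.mp hf'mem
  have hhom (u v : ℂ) : (u • f + v • g).IsHomogeneous d :=
    ((MvPolynomial.homogeneousSubmodule (Fin 3) ℂ d).add_mem
      (Submodule.smul_mem _ u hf) (Submodule.smul_mem _ v hg))
  obtain ⟨i, j, hij, hw⟩ := exists_curveWeight_eq hnorm (hhom a b) hf'0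
  -- This member has zero coefficient at the monomial `(i, j)`, and its other coefficients are
  -- the negated minors of the pencil with first index `(i, j)`.
  set h := coeffIJ d g i j • f + (-coeffIJ d f i j) • g with hh
  have hh0 : h ≠ 0 := by
    intro h0
    obtain ⟨hgz, hfz⟩ := LinearIndependent.pair_iff.mp hind _ _ h0
    rw [coeffIJ_smul_add_smul, hgz, neg_eq_zero.mp hfz] at hij
    simp at hij
  obtain ⟨k, l, hkl, hw'⟩ := exists_curveWeight_eq hnorm (hhom _ _) hh0
  refine ⟨h, Submodule.mem_span_pair.mpr ⟨_, _, rfl⟩, ?_, ?_⟩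
  · rintro ⟨c, hc⟩
    have hcoeff : coeffIJ d h i j = c * coeffIJ d (a • f + b • g) i j := by
      rw [hc, coeffIJ, MvPolynomial.coeff_smul, smul_eq_mul, coeffIJ]
    rw [hh, coeffIJ_smul_add_smul, neg_mul, mul_comm, add_neg_cancel, eq_comm,
      mul_eq_zero] at hcoeff
    rcases hcoeff with rfl | h0
    · exact hh0 (by rw [hc, zero_smul])
    · exact hij h0
  · have hm : minor d f g i j k l ≠ 0 := by
      intro hm
      apply hkl
      rw [coeffIJ_smul_add_smul]
      unfold minor at hm
      linear_combination -hm
    rw [hw, hw']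
    linarith [pencilWeight_le hnorm hm]
end

section
/- Let f, g be linearly independent homogeneous polynomials of degree d in ℂ[x,y,z], spanning a pencil P. Suppose there exists A ∈ SL(3,ℂ) such that (f∘A)_{00} = (g∘A)_{00} = 0 (i.e., the point (0:0:1) is a base point of the transformed pencil) and mult(f∘A) + mult(g∘A) > 4d/3, where for a nonzero homogeneous h of degree d with h_{00} = 0 we set mult(h) = min{ i + j : h_{ij} ≠ 0 } (the multiplicity at (0:0:1) of the curve h = 0). Then P is unstable: there exist B ∈ SL(3,ℂ) and a normalized weight triple with ω(P∘B) > (2d/3)·s. If instead mult(f∘A) + mult(g∘A) ≥ 4d/3, then P is not stable: there exist B ∈ SL(3,ℂ) and a normalized weight triple with ω(P∘B) ≥ (2d/3)·s. -/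
/-- The action of `A ∈ SL(3,ℂ)` on polynomials by the linear substitution
`(x,y,z) ↦ A·(x,y,z)`. -/
noncomputable def actSL (A : Matrix.SpecialLinearGroup (Fin 3) ℂ)
    (f : MvPolynomial (Fin 3) ℂ) : MvPolynomial (Fin 3) ℂ :=
  MvPolynomial.aeval
    (fun i => ∑ j : Fin 3,
      MvPolynomial.C ((A : Matrix (Fin 3) (Fin 3) ℂ) i j) * MvPolynomial.X j) f

/-- A degree-`d` plane curve `f` is semistable if `ω(f∘A) ≤ (d/3)·s` for every
`A ∈ SL(3,ℂ)` and every normalized weight triple, where `s = (ax-az)+(ay-az)`. -/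
def CurveSemistable (d : ℕ) (f : MvPolynomial (Fin 3) ℂ) : Prop :=
  ∀ A : Matrix.SpecialLinearGroup (Fin 3) ℂ, ∀ ax ay az : ℤ, NormTriple ax ay az →
    (curveWeight ax ay az d (actSL A f) : ℚ) ≤
      (d : ℚ) / 3 * (((ax - az) + (ay - az) : ℤ) : ℚ)

/-- A degree-`d` plane curve `f` is stable if `ω(f∘A) < (d/3)·s` for every
`A ∈ SL(3,ℂ)` and every normalized weight triple. -/
def CurveStable (d : ℕ) (f : MvPolynomial (Fin 3) ℂ) : Prop :=
  ∀ A : Matrix.SpecialLinearGroup (Fin 3) ℂ, ∀ ax ay az : ℤ, NormTriple ax ay az →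
    (curveWeight ax ay az d (actSL A f) : ℚ) <
      (d : ℚ) / 3 * (((ax - az) + (ay - az) : ℤ) : ℚ)

/-- The pencil spanned by `f` and `g` is semistable if `ω(P∘A) ≤ (2d/3)·s` for every
`A ∈ SL(3,ℂ)` and every normalized weight triple. -/
def PencilSemistable (d : ℕ) (f g : MvPolynomial (Fin 3) ℂ) : Prop :=
  ∀ A : Matrix.SpecialLinearGroup (Fin 3) ℂ, ∀ ax ay az : ℤ, NormTriple ax ay az →
    (pencilWeight ax ay az d (actSL A f) (actSL A g) : ℚ) ≤
      (2 * d : ℚ) / 3 * (((ax - az) + (ay - az) : ℤ) : ℚ)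

/-- The pencil spanned by `f` and `g` is stable if `ω(P∘A) < (2d/3)·s` for every
`A ∈ SL(3,ℂ)` and every normalized weight triple. -/
def PencilStable (d : ℕ) (f g : MvPolynomial (Fin 3) ℂ) : Prop :=
  ∀ A : Matrix.SpecialLinearGroup (Fin 3) ℂ, ∀ ax ay az : ℤ, NormTriple ax ay az →
    (pencilWeight ax ay az d (actSL A f) (actSL A g) : ℚ) <
      (2 * d : ℚ) / 3 * (((ax - az) + (ay - az) : ℤ) : ℚ)

/-- The multiplicity at the point `(0:0:1)` of the degree-`d` plane curve `h = 0`
(assuming `h_{00} = 0`): the minimum of `i + j` over nonzero coefficients `h_{ij}`. -/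
noncomputable def multAt (d : ℕ) (h : MvPolynomial (Fin 3) ℂ) : ℕ :=
  sInf {m : ℕ | ∃ i j : ℕ, coeffIJ d h i j ≠ 0 ∧ m = i + j}

/-- Substituting `A` and then `A⁻¹` gives back the original polynomial. -/
theorem actSL_leftInverse (A : Matrix.SpecialLinearGroup (Fin 3) ℂ) :
    Function.LeftInverse (actSL A⁻¹) (actSL A) := by
  intro p
  have hA : (A : Matrix (Fin 3) (Fin 3) ℂ) * ((A⁻¹ : Matrix.SpecialLinearGroup (Fin 3) ℂ) :
      Matrix (Fin 3) (Fin 3) ℂ) = 1 := by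
    rw [← Matrix.SpecialLinearGroup.coe_mul, mul_inv_cancel, Matrix.SpecialLinearGroup.coe_one]
  unfold actSL
  rw [← AlgHom.comp_apply, MvPolynomial.comp_aeval]
  conv_rhs => rw [← MvPolynomial.aeval_X_left_apply (R := ℂ) p]
  congr 2
  funext i
  simp only [map_sum, map_mul, MvPolynomial.algHom_C, MvPolynomial.algebraMap_eq,
    MvPolynomial.aeval_X, Finset.mul_sum, ← mul_assoc]
  rw [Finset.sum_comm]
  simp only [← Finset.sum_mul, ← MvPolynomial.C_mul, ← map_sum, ← Matrix.mul_apply, hA, Matrix.one_apply]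
  simp [Finset.sum_ite_eq]

theorem actSL_isHomogeneous {d : ℕ} {f : MvPolynomial (Fin 3) ℂ} (hf : f.IsHomogeneous d)
    (A : Matrix.SpecialLinearGroup (Fin 3) ℂ) : (actSL A f).IsHomogeneous d := by
  have h := hf.aeval (n := 1) (fun i => ∑ j : Fin 3,
      MvPolynomial.C ((A : Matrix (Fin 3) (Fin 3) ℂ) i j) * MvPolynomial.X j) fun i =>
    MvPolynomial.IsHomogeneous.sum _ _ _ fun j _ =>
      MvPolynomial.isHomogeneous_C_mul_X _ j
  rw [one_mul] at h
  exact h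

theorem actSL_linearIndependent {f g : MvPolynomial (Fin 3) ℂ}
    (h : LinearIndependent ℂ ![f, g]) (A : Matrix.SpecialLinearGroup (Fin 3) ℂ) :
    LinearIndependent ℂ ![actSL A f, actSL A g] := by
  rw [LinearIndependent.pair_iff] at h ⊢
  intro s t hst
  refine h s t ((actSL_leftInverse A).injective ?_)
  unfold actSL at hst ⊢
  simpa only [map_add, map_smul, map_zero] using hst

/-- Every monomial of a plane curve of degree `d` is of the form `x^i y^j z^(d-i-j)`. -/
theorem exists_coeff_eq_coeffIJ {d : ℕ} {m : Fin 3 →₀ ℕ} (hm : m.degree = d) :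
    ∃ i j : ℕ, ∀ f : MvPolynomial (Fin 3) ℂ, f.coeff m = coeffIJ d f i j := by
  refine ⟨m 0, m 1, fun f => ?_⟩
  unfold coeffIJ
  congr 1
  rw [Finsupp.degree_eq_sum, Fin.sum_univ_three] at hm
  ext k
  fin_cases k <;> simp
  omega

/-- Linearly independent curves of degree `d` have a nonzero Plücker coordinate. -/
theorem exists_minor_ne_zero {d : ℕ} {f g : MvPolynomial (Fin 3) ℂ}
    (hf : f.IsHomogeneous d) (hg : g.IsHomogeneous d) (h : LinearIndependent ℂ ![f, g]) :
    ∃ i j k l : ℕ, minor d f g i j k l ≠ 0 := by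
  by_contra! hzero
  have hf0 : f ≠ 0 := by simpa using h.ne_zero 0
  obtain ⟨m, hm⟩ := MvPolynomial.ne_zero_iff.mp hf0
  have degree_eq {p : MvPolynomial (Fin 3) ℂ} (hp : p.IsHomogeneous d) {n : Fin 3 →₀ ℕ}
      (hn : p.coeff n ≠ 0) : n.degree = d := by
    by_contra hne
    exact hn (hp.coeff_eq_zero hne)
  obtain ⟨i, j, hij⟩ := exists_coeff_eq_coeffIJ (degree_eq hf hm)
  have key : (-coeffIJ d g i j) • f + coeffIJ d f i j • g = 0 := by
    ext n
    rw [MvPolynomial.coeff_add, MvPolynomial.coeff_smul, MvPolynomial.coeff_smul,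
      MvPolynomial.coeff_zero, smul_eq_mul, smul_eq_mul]
    by_cases hn : n.degree = d
    · obtain ⟨k, l, hkl⟩ := exists_coeff_eq_coeffIJ hn
      have := hzero i j k l
      unfold minor at this
      rw [hkl, hkl]
      linear_combination this
    · rw [hf.coeff_eq_zero hn, hg.coeff_eq_zero hn]
      ring
  exact hm ((hij f).trans (LinearIndependent.pair_iff.mp h _ _ key).2)

theorem multAt_le {d : ℕ} {h : MvPolynomial (Fin 3) ℂ} {i j : ℕ} (hij : coeffIJ d h i j ≠ 0) :
    multAt d h ≤ i + j :=
  Nat.sInf_le ⟨i, j, hij, rfl⟩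

/-- At the weight triple `(1, 1, -2)`, the weight of a pencil is at least three times the sum of
the multiplicities of its generators at `(0:0:1)`. -/
theorem three_mul_multAt_add_le_pencilWeight {d : ℕ} {f g : MvPolynomial (Fin 3) ℂ}
    (hf : f.IsHomogeneous d) (hg : g.IsHomogeneous d) (h : LinearIndependent ℂ ![f, g]) :
    3 * ((multAt d f : ℤ) + multAt d g) ≤ pencilWeight 1 1 (-2) d f g := by
  obtain ⟨i, j, k, l, hne⟩ := exists_minor_ne_zero hf hg h
  refine le_csInf ⟨_, i, j, k, l, hne, rfl⟩ ?_
  rintro w ⟨i, j, k, l, hne, rfl⟩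
  by_cases hfg : coeffIJ d f i j * coeffIJ d g k l = 0
  · have hgf : coeffIJ d g i j * coeffIJ d f k l ≠ 0 := fun h0 => hne (by simp [minor, hfg, h0])
    have h1 := multAt_le (left_ne_zero_of_mul hgf)
    have h2 := multAt_le (right_ne_zero_of_mul hgf)
    omega
  · have h1 := multAt_le (left_ne_zero_of_mul hfg)
    have h2 := multAt_le (right_ne_zero_of_mul hfg)
    omega

/-- If after some `A ∈ SL(3,ℂ)` the point `(0:0:1)` is a base point
of the pencil and the multiplicities of the transformed generators there sum to more
than `4d/3` (resp. at least `4d/3`), then the pencil is unstable (resp. not stable). -/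
theorem pencil_unstable_of_mult_at_base_point
    (d : ℕ) (hd : 1 ≤ d) (f g : MvPolynomial (Fin 3) ℂ)
    (hf : f.IsHomogeneous d) (hg : g.IsHomogeneous d)
    (hind : LinearIndependent ℂ ![f, g])
    (A : Matrix.SpecialLinearGroup (Fin 3) ℂ)
    (hf0 : coeffIJ d (actSL A f) 0 0 = 0) (hg0 : coeffIJ d (actSL A g) 0 0 = 0) :
    (((multAt d (actSL A f) : ℚ) + (multAt d (actSL A g) : ℚ) > 4 * d / 3) →
      ∃ B : Matrix.SpecialLinearGroup (Fin 3) ℂ, ∃ ax ay az : ℤ, NormTriple ax ay az ∧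
        (pencilWeight ax ay az d (actSL B f) (actSL B g) : ℚ) >
          (2 * d : ℚ) / 3 * (((ax - az) + (ay - az) : ℤ) : ℚ)) ∧
    (((multAt d (actSL A f) : ℚ) + (multAt d (actSL A g) : ℚ) ≥ 4 * d / 3) →
      ∃ B : Matrix.SpecialLinearGroup (Fin 3) ℂ, ∃ ax ay az : ℤ, NormTriple ax ay az ∧
        (pencilWeight ax ay az d (actSL B f) (actSL B g) : ℚ) ≥
          (2 * d : ℚ) / 3 * (((ax - az) + (ay - az) : ℤ) : ℚ)) := by
  have hT : NormTriple 1 1 (-2) := by norm_num [NormTriple]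
  have hw : 3 * ((multAt d (actSL A f) : ℚ) + multAt d (actSL A g)) ≤
      (pencilWeight 1 1 (-2) d (actSL A f) (actSL A g) : ℚ) := by
    exact_mod_cast three_mul_multAt_add_le_pencilWeight (actSL_isHomogeneous hf A)
      (actSL_isHomogeneous hg A) (actSL_linearIndependent hind A)
  refine ⟨fun h => ⟨A, 1, 1, -2, hT, ?_⟩, fun h => ⟨A, 1, 1, -2, hT, ?_⟩⟩
  · push_cast
    linarith
  · push_cast
    linarith
end
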